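/- arXiv:1508.02348 — 2 statements merged into one kernel-verified Lean document; each statement's English description precedes it below -/
import Mathlib

section
/- Let γ ≥ 3 and α ≥ 1 be integers and set n = 2α(γ−1)(γ+1). Then the energy of the circulant graph C^{1,γ}_n is given by E(C^{1,γ}_n) = 4·∑_{m∈{1,γ}} ( sin(πm(⌈γ/2⌉ + 1/(2α(γ−1)))/(γ+1))·sin(⌈γ/2⌉πm/(γ+1)) / (sin(πm/(2α(γ−1)(γ+1)))·sin(πm/(γ+1))) − sin(πm(⌈γ/2⌉ − 1 + 1/(2α(γ+1)))/(γ−1))·sin((⌈γ/2⌉−1)πm/(γ−1)) / (sin(πm/(2α(γ−1)(γ+1)))·sin(πm/(γ−1))) ), where ⌈·⌉ is the ceiling function. -/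
open Real Finset Matrix

/-- The circulant graph `C^{1,γ}_n` on vertex set `ℤ/nℤ`: distinct vertices `u, v`
are adjacent iff `u - v ∈ {1, -1, γ, -γ}` (mod `n`). -/
def circGraph (n γ : ℕ) : SimpleGraph (ZMod n) :=
  SimpleGraph.circulantGraph ({1, (γ : ZMod n)} : Set (ZMod n))

noncomputable instance (n γ : ℕ) : DecidableRel (circGraph n γ).Adj :=
  Classical.decRel _

/-- The adjacency matrix of a finite simple graph is Hermitian as a real matrix. -/
theorem adjMatrix_isHermitian {V : Type*} [Fintype V] [DecidableEq V]
    (G : SimpleGraph V) [DecidableRel G.Adj] : (G.adjMatrix ℝ).IsHermitian := by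
  rw [Matrix.IsHermitian, Matrix.conjTranspose_eq_transpose_of_trivial]
  exact G.isSymm_adjMatrix

/-- The energy of a finite simple graph: the sum of the absolute values of the
eigenvalues (with multiplicity) of its adjacency matrix. -/
noncomputable def graphEnergy {V : Type*} [Fintype V] [DecidableEq V]
    (G : SimpleGraph V) [DecidableRel G.Adj] : ℝ :=
  ∑ i, |(adjMatrix_isHermitian G).eigenvalues i|

/-- The `j`-th eigenvalue. -/
noncomputable def lam (n γ j : ℕ) : ℝ :=
  2 * Real.cos (2 * π * j / n) + 2 * Real.cos (2 * π * γ * j / n)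

theorem char_add_neg (n : ℕ) [NeZero n] (c j : ℕ) :
    (ZMod.stdAddChar ((c : ZMod n) * (j : ZMod n)) + ZMod.stdAddChar (-((c : ZMod n) * (j : ZMod n))) : ℂ)
      = ((2 * Real.cos (2 * π * c * j / n) : ℝ) : ℂ) := by
  have h1 : ((c : ZMod n) * (j : ZMod n)) = (((c * j : ℕ) : ℤ) : ZMod n) := by push_cast; rfl
  have h2 : (-((c : ZMod n) * (j : ZMod n))) = ((-((c * j : ℕ) : ℤ) : ℤ) : ZMod n) := by
    push_cast; rfl
  rw [h2, h1, ZMod.stdAddChar_coe, ZMod.stdAddChar_coe]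
  push_cast
  rw [Complex.two_cos]
  congr 2 <;> ring

theorem adj_split (n γ : ℕ) [NeZero n] (hγ : 3 ≤ γ) (hn : 2 * γ < n) (i j : ZMod n) :
    (((circGraph n γ).adjMatrix ℝ i j : ℝ) : ℂ) =
      (if j = i - 1 then 1 else 0) + (if j = i + 1 then 1 else 0)
      + (if j = i - γ then 1 else 0) + (if j = i + γ then 1 else 0) := by
  have key : ∀ m : ℕ, 0 < m → m < n → ((m : ℕ) : ZMod n) ≠ 0 := by
    intro m h0 h1 h
    rw [ZMod.natCast_eq_zero_iff] at h
    exact absurd (Nat.le_of_dvd h0 h) (by omega)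
  have k1 : (1 : ZMod n) ≠ 0 := by simpa using key 1 (by omega) (by omega)
  have k2 : (1 : ZMod n) + 1 ≠ 0 := by
    have := key (1 + 1) (by omega) (by omega); rw [Nat.cast_add, Nat.cast_one] at this; exact this
  have k3 : (γ : ZMod n) ≠ 0 := key γ (by omega) (by omega)
  have k4 : (γ : ZMod n) + γ ≠ 0 := by
    have := key (γ + γ) (by omega) (by omega); push_cast at this; exact this
  have k5 : (γ : ZMod n) + 1 ≠ 0 := by
    have := key (γ + 1) (by omega) (by omega); push_cast at this; exact this
  have k6 : (γ : ZMod n) - 1 ≠ 0 := by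
    have := key (γ - 1) (by omega) (by omega)
    rw [Nat.cast_sub (by omega)] at this; push_cast at this; exact this
  have hadj : (circGraph n γ).Adj i j ↔
      (j = i - 1 ∨ j = i + 1 ∨ j = i - γ ∨ j = i + γ) := by
    simp only [circGraph, SimpleGraph.circulantGraph_adj, Set.mem_insert_iff, Set.mem_singleton_iff]
    grind
  rw [SimpleGraph.adjMatrix_apply]
  simp only [hadj]
  generalize (γ : ZMod n) = g at *
  by_cases h1 : j = i - 1
  · have a2 : ¬ j = i + 1 := by grind
    have a3 : ¬ j = i - g := by grind
    have a4 : ¬ j = i + g := by grind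
    rw [if_pos (by tauto), if_pos h1, if_neg a2, if_neg a3, if_neg a4]; simp
  by_cases h2 : j = i + 1
  · have a3 : ¬ j = i - g := by grind
    have a4 : ¬ j = i + g := by grind
    rw [if_pos (by tauto), if_neg h1, if_pos h2, if_neg a3, if_neg a4]; simp
  by_cases h3 : j = i - g
  · have a4 : ¬ j = i + g := by grind
    rw [if_pos (by tauto), if_neg h1, if_neg h2, if_pos h3, if_neg a4]; simp
  by_cases h4 : j = i + g
  · rw [if_pos (by tauto), if_neg h1, if_neg h2, if_neg h3, if_pos h4]; simp
  rw [if_neg (by tauto), if_neg h1, if_neg h2, if_neg h3, if_neg h4]; simp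

theorem charpoly_circ (n γ : ℕ) [NeZero n] (hγ : 3 ≤ γ) (hn : 2 * γ < n) :
    ((circGraph n γ).adjMatrix ℝ).charpoly =
      ∏ k : ZMod n, (Polynomial.X - Polynomial.C (lam n γ k.val)) := by
  apply Polynomial.map_injective Complex.ofRealHom Complex.ofRealHom.injective
  rw [← Matrix.charpoly_map]
  set A := ((circGraph n γ).adjMatrix ℝ).map Complex.ofRealHom with hA
  set ψ : AddChar (ZMod n) ℂ := ZMod.stdAddChar with hψ
  let U : Matrix (ZMod n) (ZMod n) ℂ := Matrix.of fun i k => ψ (i * k)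
  let V : Matrix (ZMod n) (ZMod n) ℂ := Matrix.of fun k i => (n : ℂ)⁻¹ * ψ (-(i * k))
  let D : Matrix (ZMod n) (ZMod n) ℂ := Matrix.diagonal fun k => ((lam n γ k.val : ℝ) : ℂ)
  have hn0 : (n : ℂ) ≠ 0 := by exact_mod_cast NeZero.ne n
  have hUV : U * V = 1 := by
    ext i k
    rw [Matrix.mul_apply, Matrix.one_apply]
    have : ∀ x, U i x * V x k = (n : ℂ)⁻¹ * ψ (x * (i - k)) := by
      intro x
      simp only [U, V, Matrix.of_apply]
      rw [mul_left_comm, ← AddChar.map_add_eq_mul]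
      congr 2; ring
    simp only [this, ← Finset.mul_sum]
    rw [AddChar.sum_mulShift _ (ZMod.isPrimitive_stdAddChar n)]
    simp only [sub_eq_zero, ZMod.card]
    split_ifs <;> simp [hn0]
  have hAU : A * U = U * D := by
    ext i k
    rw [Matrix.mul_diagonal, Matrix.mul_apply]
    have : ∀ x, A i x * U x k = (if x = i - 1 then ψ (x * k) else 0) + (if x = i + 1 then ψ (x * k) else 0)
      + (if x = i - γ then ψ (x * k) else 0) + (if x = i + γ then ψ (x * k) else 0) := by
      intro x
      have : A i x = (((circGraph n γ).adjMatrix ℝ i x : ℝ) : ℂ) := rfl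
      rw [this, adj_split n γ hγ hn]
      simp only [U, Matrix.of_apply, add_mul, ite_mul, one_mul, zero_mul]
    simp only [this, Finset.sum_add_distrib, Finset.sum_ite_eq', Finset.mem_univ, if_true]
    have e1 := char_add_neg n 1 k.val
    have e2 := char_add_neg n γ k.val
    simp only [ZMod.natCast_zmod_val, Nat.cast_one, one_mul, mul_one] at e1 e2
    rw [← hψ] at e1 e2
    simp only [lam]
    rw [Complex.ofReal_add, ← e1, ← e2]
    simp only [U, Matrix.of_apply, mul_add, ← AddChar.map_add_eq_mul]
    ring_nf
  have hchar : A.charpoly = D.charpoly := by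
    have h1 : A = U * (D * V) := by
      rw [← mul_assoc, ← hAU, mul_assoc, hUV, mul_one]
    have hVU : V * U = 1 := mul_eq_one_comm.mp hUV
    rw [h1, Matrix.charpoly_mul_comm, mul_assoc, hVU, mul_one]
  rw [hchar, Matrix.charpoly_diagonal, Polynomial.map_prod]
  simp

theorem energy_eq (n γ : ℕ) [NeZero n] (hγ : 3 ≤ γ) (hn : 2 * γ < n) :
    graphEnergy (circGraph n γ) = ∑ j ∈ Finset.range n, |lam n γ j| := by
  have h1 := (adjMatrix_isHermitian (circGraph n γ)).roots_charpoly_eq_eigenvalues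
  have h2 : (∏ k : ZMod n, (Polynomial.X - Polynomial.C (lam n γ k.val))).roots
      = Multiset.map (fun k : ZMod n => lam n γ k.val) Finset.univ.val := by
    rw [← Polynomial.roots_multiset_prod_X_sub_C (Multiset.map (fun k : ZMod n => lam n γ k.val) _),
      Multiset.map_map]
    rfl
  rw [charpoly_circ n γ hγ hn, h2] at h1
  have h3 := congrArg (fun s => (Multiset.map (fun x : ℝ => |x|) s).sum) h1
  simp only [Multiset.map_map] at h3
  have h4 : graphEnergy (circGraph n γ) = ∑ k : ZMod n, |lam n γ k.val| := h3.symm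
  rw [h4]
  refine Finset.sum_bij (fun k _ => k.val) ?_ ?_ ?_ ?_
  · intro a _; simpa using ZMod.val_lt a
  · intro a _ b _ h; exact ZMod.val_injective n h
  · intro b hb
    exact ⟨(b : ZMod n), Finset.mem_univ _, ZMod.val_cast_of_lt (by simpa using hb)⟩
  · intro a _; rfl

theorem fold_sum (g : ℕ → ℝ) (h : ℕ) (hg : ∀ j ≤ 2 * h, g (2 * h - j) = g j) :
    ∑ j ∈ Finset.range (2 * h), g j = 2 * ∑ j ∈ Finset.range (h + 1), g j - g 0 - g h := by
  have e0 : g (2 * h) = g 0 := by simpa using hg 0 (by omega)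
  have e1 : ∑ j ∈ Finset.range (2 * h + 1), g j
      = ∑ j ∈ Finset.range (h + 1), g j + ∑ i ∈ Finset.range h, g (h + 1 + i) := by
    rw [← Finset.sum_range_add]; congr 2; omega
  have e2 : ∑ i ∈ Finset.range h, g (h + 1 + i) = ∑ i ∈ Finset.range h, g i := by
    rw [← Finset.sum_range_reflect]
    apply Finset.sum_congr rfl
    intro i hi
    rw [Finset.mem_range] at hi
    rw [← hg i (by omega)]
    congr 1; omega
  have e3 := Finset.sum_range_succ g (2 * h)
  have e4 := Finset.sum_range_succ g h
  linarith

theorem dirichlet (θ : ℝ) (p : ℕ) :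
    (2 * ∑ j ∈ Finset.range (p + 1), Real.cos (2 * θ * j) - 1) * Real.sin θ
      = Real.sin ((2 * p + 1) * θ) := by
  induction p with
  | zero => simp; ring
  | succ p ih =>
    rw [Finset.sum_range_succ]
    have h1 : Real.sin ((2 * ((p + 1 : ℕ) : ℝ) + 1) * θ)
        = Real.sin (2 * θ * ((p + 1 : ℕ) : ℝ) + θ) := by congr 1; ring
    have h2 : Real.sin ((2 * (p : ℝ) + 1) * θ)
        = Real.sin (2 * θ * ((p + 1 : ℕ) : ℝ) - θ) := by congr 1; push_cast; ring
    rw [h1, Real.sin_add]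
    rw [h2, Real.sin_sub] at ih
    linarith

theorem circ_sum_sin (x y : ℝ) (c : ℕ) :
    (∑ k ∈ Finset.range c, Real.sin (x + (2 * k + 1) * y)) * Real.sin y
      = Real.sin (x + c * y) * Real.sin (c * y) := by
  induction c with
  | zero => simp
  | succ c ih =>
    rw [Finset.sum_range_succ, add_mul, ih]
    have h1 : x + (2 * (c : ℝ) + 1) * y = (x + c * y) + (c * y + y) := by ring
    have h2 : x + ((c + 1 : ℕ) : ℝ) * y = (x + c * y) + y := by push_cast; ring
    have h3 : ((c + 1 : ℕ) : ℝ) * y = c * y + y := by push_cast; ring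
    rw [h1, h2, h3]
    generalize x + c * y = A
    generalize (c : ℝ) * y = B
    rw [Real.sin_add A, Real.sin_add A, Real.cos_add B, Real.sin_add B]
    have := Real.sin_sq_add_cos_sq y
    linear_combination (-(Real.sin A * Real.sin B)) * this

theorem abs_cos_eq (x : ℝ) (u : ℕ) (h1 : u * π - π / 2 ≤ x) (h2 : x ≤ u * π + π / 2) :
    |Real.cos x| = (-1) ^ u * Real.cos x := by
  have h := Real.cos_nonneg_of_neg_pi_div_two_le_of_le (x := x - u * π) (by linarith) (by linarith)
  rw [Real.cos_sub_nat_mul_pi] at h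
  rw [← abs_of_nonneg h, abs_mul]
  simp

theorem count_ge (u c : ℕ) :
    ∑ k ∈ Finset.range c, (if u ≤ k then (1 : ℝ) else 0) = ((c - u : ℕ) : ℝ) := by
  induction c with
  | zero => simp
  | succ c ih =>
    rw [Finset.sum_range_succ, ih]
    split_ifs with h
    · rw [Nat.succ_sub h]; push_cast; ring
    · rw [Nat.sub_eq_zero_of_le (by omega), Nat.sub_eq_zero_of_le (by omega)]; simp

theorem exists_block (s j : ℕ) (hs : 1 ≤ s) :
    ∃ u : ℕ, 2 * s * u < j + s ∧ j ≤ s * (2 * u + 1) := by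
  refine ⟨(j + s - 1) / (2 * s), ?_, ?_⟩
  · have := Nat.mul_div_le (j + s - 1) (2 * s)
    omega
  · have := Nat.lt_mul_div_succ (j + s - 1) (b := 2 * s) (by omega)
    rw [mul_add] at this
    rw [mul_add, ← mul_assoc, mul_comm s 2]
    omega

theorem count_block (s j u c : ℕ) (h1 : 2 * s * u < j + s) (h2 : j ≤ s * (2 * u + 1)) (hu : u ≤ c) :
    ∑ k ∈ Finset.range c, (if j ≤ s * (2 * k + 1) then (1 : ℝ) else 0) = (c : ℝ) - u := by
  rw [← Nat.cast_sub hu, ← count_ge]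
  apply Finset.sum_congr rfl
  intro k _
  have : j ≤ s * (2 * k + 1) ↔ u ≤ k := by
    constructor
    · intro h
      by_contra hk
      push Not at hk
      have : s * (2 * (k + 1)) ≤ s * (2 * u) := by gcongr; omega
      nlinarith
    · intro h
      have : s * (2 * u + 1) ≤ s * (2 * k + 1) := by gcongr
      omega
  simp only [this]

theorem abs_cos_block (s j u : ℕ) (hs : 1 ≤ s) (h1 : 2 * s * u < j + s) (h2 : j ≤ s * (2 * u + 1)) :
    |Real.cos (π * j / (2 * s))| = (-1) ^ u * Real.cos (π * j / (2 * s)) := by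
  have hs' : (0 : ℝ) < s := by exact_mod_cast hs
  have h1' : (2 * s * u : ℝ) < j + s := by exact_mod_cast h1
  have h2' : (j : ℝ) ≤ s * (2 * u + 1) := by exact_mod_cast h2
  have hp := Real.pi_pos
  apply abs_cos_eq
  · rw [le_div_iff₀ (by positivity)]
    nlinarith
  · rw [div_le_iff₀ (by positivity)]
    nlinarith

theorem lam_eq (a α j : ℕ) (ha : 2 ≤ a) (hα : 1 ≤ α) :
    lam (2 * (α * a * (a + 2))) (a + 1) j =
      4 * (Real.cos (π * j / (2 * (α * a : ℕ))) * Real.cos (π * j / (2 * (α * (a + 2) : ℕ)))) := by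
  have ha' : (a : ℝ) ≠ 0 := by positivity
  have hα' : (α : ℝ) ≠ 0 := by positivity
  have hb' : (a : ℝ) + 2 ≠ 0 := by positivity
  unfold lam
  have e1 : 2 * π * j / (2 * (α * a * (a + 2)) : ℕ)
     = π * j / (2 * (α * a : ℕ)) - π * j / (2 * (α * (a + 2) : ℕ)) := by
    push_cast; field_simp; ring
  have e2 : 2 * π * (a + 1 : ℕ) * j / (2 * (α * a * (a + 2)) : ℕ)
     = π * j / (2 * (α * a : ℕ)) + π * j / (2 * (α * (a + 2) : ℕ)) := by
    push_cast; field_simp; ring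
  rw [e1, e2, Real.cos_add, Real.cos_sub]; ring

theorem abs_lam (a α j c : ℕ) (ha : 2 ≤ a) (hα : 1 ≤ α) (hj : j ≤ α * a * (a + 2))
    (hc : c = (a + 2) / 2) :
    |lam (2 * (α * a * (a + 2))) (a + 1) j| =
      lam (2 * (α * a * (a + 2))) (a + 1) j *
       (2 * (∑ k ∈ Finset.range c, (if j ≤ α * a * (2 * k + 1) then (1 : ℝ) else 0)
         - ∑ k ∈ Finset.range (c - 1), (if j ≤ α * (a + 2) * (2 * k + 1) then (1 : ℝ) else 0)) - 1) := by
  have hs : 1 ≤ α * a := Nat.mul_pos hα (by omega)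
  have ht : 1 ≤ α * (a + 2) := Nat.mul_pos hα (by omega)
  obtain ⟨u, hu1, hu2⟩ := exists_block (α * a) j hs
  obtain ⟨v, hv1, hv2⟩ := exists_block (α * (a + 2)) j ht
  have hub : 2 * u < a + 3 := by
    have : α * a * (2 * u) < α * a * (a + 3) := by nlinarith
    exact Nat.lt_of_mul_lt_mul_left this
  have hvb : 2 * v < a + 1 := by
    have : α * (a + 2) * (2 * v) < α * (a + 2) * (a + 1) := by nlinarith
    exact Nat.lt_of_mul_lt_mul_left this
  have hvu : v ≤ u := by
    by_contra hlt
    push Not at hlt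
    have : α * (a + 2) * (2 * v) < α * a * (2 * u + 1) + α * (a + 2) := by nlinarith
    have : α * ((a + 2) * (2 * v)) < α * (a * (2 * u + 1) + (a + 2)) := by nlinarith
    have := Nat.lt_of_mul_lt_mul_left this
    nlinarith
  have huv : u ≤ v + 1 := by
    by_contra hlt
    push Not at hlt
    have : α * (a * (2 * u)) < α * ((a + 2) * (2 * v + 1) + a) := by nlinarith
    have := Nat.lt_of_mul_lt_mul_left this
    have h5 : a * (2 * (v + 2)) ≤ a * (2 * u) := by gcongr; omega
    have : a < 2 * v + 1 := by nlinarith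
    omega
  rw [count_block _ _ u c hu1 hu2 (by omega), count_block _ _ v (c - 1) hv1 hv2 (by omega)]
  rw [lam_eq a α j ha hα, abs_mul, abs_mul, abs_cos_block _ _ u hs hu1 hu2,
    abs_cos_block _ _ v ht hv1 hv2, Nat.cast_sub (by omega : 1 ≤ c)]
  rw [abs_of_pos (by norm_num : (0 : ℝ) < 4)]
  generalize Real.cos (π * j / (2 * (α * a : ℕ))) = X
  generalize Real.cos (π * j / (2 * (α * (a + 2) : ℕ))) = Y
  have hsq : ((-1 : ℝ) ^ v) * (-1) ^ v = 1 := by rw [← mul_pow]; simp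
  rcases (by omega : u = v ∨ u = v + 1) with rfl | rfl
  · push_cast
    linear_combination 4 * X * Y * hsq
  · push_cast
    rw [pow_succ]
    linear_combination (-4) * X * Y * hsq

theorem lam_reflect (h γ j : ℕ) (hh : 1 ≤ h) (hj : j ≤ 2 * h) :
    lam (2 * h) γ (2 * h - j) = lam (2 * h) γ j := by
  have hh' : (h : ℝ) ≠ 0 := by positivity
  unfold lam
  have e1 : 2 * π * ((2 * h - j : ℕ) : ℝ) / (2 * h : ℕ) = 2 * π - 2 * π * j / (2 * h : ℕ) := by
    rw [Nat.cast_sub hj]; push_cast; field_simp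
  have e2 : 2 * π * γ * ((2 * h - j : ℕ) : ℝ) / (2 * h : ℕ)
      = γ * (2 * π) - 2 * π * γ * j / (2 * h : ℕ) := by
    rw [Nat.cast_sub hj]; push_cast; field_simp
  rw [e1, e2, Real.cos_two_pi_sub, Real.cos_nat_mul_two_pi_sub]

/-- The folded sum. -/
def foldT (h : ℕ) (g : ℕ → ℝ) : ℝ := 2 * ∑ j ∈ Finset.range (h + 1), g j - g 0 - g h

theorem foldT_ind (h p : ℕ) (f : ℕ → ℝ) (hp : p < h) :
    foldT h (fun j => f j * (if j ≤ p then (1 : ℝ) else 0)) =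
      2 * ∑ j ∈ Finset.range (p + 1), f j - f 0 := by
  unfold foldT
  have : ∑ j ∈ Finset.range (h + 1), f j * (if j ≤ p then (1 : ℝ) else 0)
      = ∑ j ∈ Finset.range (p + 1), f j := by
    simp only [mul_ite, mul_one, mul_zero]
    rw [← Finset.sum_filter]
    apply Finset.sum_congr _ (fun _ _ => rfl)
    ext j; simp; omega
  rw [this]
  simp [hp]

theorem foldT_lin (h c d : ℕ) (f : ℕ → ℝ) (P Q : ℕ → ℕ → ℝ) :
    foldT h (fun j => f j * (2 * (∑ k ∈ Finset.range c, P k j - ∑ k ∈ Finset.range d, Q k j) - 1))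
    = 2 * (∑ k ∈ Finset.range c, foldT h (fun j => f j * P k j)
        - ∑ k ∈ Finset.range d, foldT h (fun j => f j * Q k j)) - foldT h f := by
  unfold foldT
  simp only [Finset.sum_sub_distrib, ← Finset.mul_sum]
  rw [Finset.sum_comm, Finset.sum_comm (s := Finset.range d)]
  simp only [mul_sub, Finset.sum_sub_distrib, ← Finset.mul_sum, mul_one]
  simp only [mul_left_comm _ (2 : ℝ), ← Finset.mul_sum]
  ring

theorem foldT_congr (h : ℕ) (f g : ℕ → ℝ) (H : ∀ j ≤ h, f j = g j) : foldT h f = foldT h g := by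
  unfold foldT
  rw [H 0 (by omega), H h le_rfl, Finset.sum_congr rfl]
  intro j hj
  exact H j (by simp at hj; omega)

theorem sum_lam (n γ p : ℕ) (h1 : Real.sin (π / n) ≠ 0) (hg : Real.sin (π * γ / n) ≠ 0) :
    2 * ∑ j ∈ Finset.range (p + 1), lam n γ j - lam n γ 0 =
      2 * (Real.sin ((2 * p + 1) * (π / n)) / Real.sin (π / n)
        + Real.sin ((2 * p + 1) * (π * γ / n)) / Real.sin (π * γ / n)) := by
  rw [← dirichlet, ← dirichlet, mul_div_cancel_right₀ _ h1, mul_div_cancel_right₀ _ hg]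
  unfold lam
  rw [Finset.sum_add_distrib, ← Finset.mul_sum, ← Finset.mul_sum]
  have e1 : ∀ j : ℕ, 2 * π * j / n = 2 * (π / n) * j := fun j => by ring
  have e2 : ∀ j : ℕ, 2 * π * γ * j / n = 2 * (π * γ / n) * j := fun j => by ring
  simp only [e1, e2]
  simp
  ring

theorem foldT_lam (h γ : ℕ) (hh : 1 ≤ h) (h1 : Real.sin (π / (2 * h : ℕ)) ≠ 0)
    (hg : Real.sin (π * γ / (2 * h : ℕ)) ≠ 0) : foldT h (lam (2 * h) γ) = 0 := by
  have hh' : (h : ℝ) ≠ 0 := by positivity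
  unfold foldT
  rw [sum_lam _ _ _ h1 hg]
  have e1 : (2 * (h : ℝ) + 1) * (π / (2 * h : ℕ)) = π / (2 * h : ℕ) + π := by
    push_cast; field_simp; ring
  have e2 : (2 * (h : ℝ) + 1) * (π * γ / (2 * h : ℕ)) = π * γ / (2 * h : ℕ) + γ * π := by
    push_cast; field_simp; ring
  have e3 : 2 * π * (h : ℝ) / (2 * h : ℕ) = π := by push_cast; field_simp
  have e4 : 2 * π * γ * (h : ℝ) / (2 * h : ℕ) = γ * π := by push_cast; field_simp
  unfold lam
  rw [e1, e2, e3, e4, Real.sin_add_pi, Real.sin_add_nat_mul_pi, Real.cos_nat_mul_pi, Real.cos_pi,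
    neg_div, div_self h1, mul_div_cancel_right₀ _ hg]
  ring

theorem sin_ne (γ N : ℕ) (hγ : 1 ≤ γ) (hN : γ < N) : Real.sin (π * γ / N) ≠ 0 := by
  have hp := Real.pi_pos
  have h1 : (0 : ℝ) < γ := by exact_mod_cast hγ
  have h2 : (γ : ℝ) < N := by exact_mod_cast hN
  apply ne_of_gt
  apply Real.sin_pos_of_pos_of_lt_pi
  · have : (0 : ℝ) < N := by linarith
    positivity
  · rw [div_lt_iff₀ (by linarith)]
    gcongr

theorem energy_sum (a α c : ℕ) (ha : 2 ≤ a) (hα : 1 ≤ α) (hc : c = (a + 2) / 2) :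
    ∑ j ∈ Finset.range (2 * (α * a * (a + 2))), |lam (2 * (α * a * (a + 2))) (a + 1) j| =
    4 * ∑ m ∈ ({1, a + 1} : Finset ℕ),
      ((∑ k ∈ Finset.range c, Real.sin ((2 * (α * a * (2 * k + 1) : ℕ) + 1) * (π * m / (2 * (α * a * (a + 2)) : ℕ)))) / Real.sin (π * m / (2 * (α * a * (a + 2)) : ℕ))
      - (∑ k ∈ Finset.range (c - 1), Real.sin ((2 * (α * (a + 2) * (2 * k + 1) : ℕ) + 1) * (π * m / (2 * (α * a * (a + 2)) : ℕ)))) / Real.sin (π * m / (2 * (α * a * (a + 2)) : ℕ))) := by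
  have hs : 1 ≤ α * a := Nat.mul_pos hα (by omega)
  have ht : 1 ≤ α * (a + 2) := Nat.mul_pos hα (by omega)
  have hcomm : α * a * (a + 2) = α * (a + 2) * a := by ring
  have hbig : a + 2 ≤ α * a * (a + 2) := Nat.le_mul_of_pos_left _ hs
  have hp : ∀ k ∈ Finset.range c, α * a * (2 * k + 1) < α * a * (a + 2) := by
    intro k hk
    rw [Finset.mem_range] at hk
    exact Nat.mul_lt_mul_of_pos_left (by omega) hs
  have hq : ∀ k ∈ Finset.range (c - 1), α * (a + 2) * (2 * k + 1) < α * a * (a + 2) := by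
    intro k hk
    rw [Finset.mem_range] at hk
    rw [hcomm]
    exact Nat.mul_lt_mul_of_pos_left (by omega) ht
  have habs := fun j hj => abs_lam a α j c ha hα hj hc
  generalize α * a * (a + 2) = h at *
  have h1 : Real.sin (π / (2 * h : ℕ)) ≠ 0 := by
    have := sin_ne 1 (2 * h) le_rfl (by omega)
    simpa using this
  have hg : Real.sin (π * (a + 1 : ℕ) / (2 * h : ℕ)) ≠ 0 := sin_ne _ _ (by omega) (by omega)
  rw [fold_sum _ h (fun j hj => by rw [lam_reflect h _ j (by omega) hj])]
  change foldT h (fun j => |lam (2 * h) (a + 1) j|) = _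
  rw [foldT_congr h _ _ habs,
    foldT_lin h c (c - 1) (lam (2 * h) (a + 1)) (fun k j => if j ≤ α * a * (2 * k + 1) then (1 : ℝ) else 0)
     (fun k j => if j ≤ α * (a + 2) * (2 * k + 1) then (1 : ℝ) else 0),
    foldT_lam h _ (by omega) h1 hg]
  rw [Finset.sum_congr rfl (fun k hk => (foldT_ind h _ (lam (2 * h) (a + 1)) (hp k hk)).trans
      (sum_lam _ _ _ h1 hg)),
    Finset.sum_congr rfl (fun k hk => (foldT_ind h _ (lam (2 * h) (a + 1)) (hq k hk)).trans
      (sum_lam _ _ _ h1 hg))]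
  rw [Finset.sum_pair (by omega : (1 : ℕ) ≠ a + 1)]
  simp only [← Finset.mul_sum, Finset.sum_add_distrib, Finset.sum_div, Nat.cast_one, mul_one]
  ring

theorem sin_ne' (a m : ℕ) (ha : 2 ≤ a) (hm : m = 1 ∨ m = a + 1) : Real.sin (π * m / a) ≠ 0 := by
  have h1 := sin_ne 1 a le_rfl (by omega)
  rcases hm with rfl | rfl
  · exact h1
  · have ha' : (a : ℝ) ≠ 0 := by positivity
    have : π * (a + 1 : ℕ) / a = π * (1 : ℕ) / a + π := by push_cast; field_simp; ring
    rw [this, Real.sin_add_pi]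
    exact neg_ne_zero.mpr h1

theorem term_eq (x y S A B z : ℝ) (c : ℕ) (hy : Real.sin y ≠ 0)
    (hS : S = ∑ k ∈ Finset.range c, Real.sin (x + (2 * k + 1) * y))
    (hA : A = x + c * y) (hB : B = c * y) :
    S / z = Real.sin A * Real.sin B / (z * Real.sin y) := by
  rw [hA, hB, ← circ_sum_sin, ← hS, mul_div_mul_right _ _ hy]

/-- For integers `γ ≥ 3`, `α ≥ 1` and `n = 2α(γ-1)(γ+1)`, the closed form of the
energy of the circulant graph `C^{1,γ}_n`. Here `⌈γ/2⌉ = (γ+1)/2` (natural division). -/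
theorem energy_circulant_closed_form (γ α n : ℕ) [NeZero n] (hγ : 3 ≤ γ) (hα : 1 ≤ α)
    (hn : n = 2 * α * (γ - 1) * (γ + 1)) :
    graphEnergy (circGraph n γ) =
      4 * ∑ m ∈ ({1, γ} : Finset ℕ),
        (Real.sin (π * m * ((((γ + 1) / 2 : ℕ) : ℝ) + 1 / (2 * α * ((γ : ℝ) - 1))) / ((γ : ℝ) + 1)) *
            Real.sin ((((γ + 1) / 2 : ℕ) : ℝ) * π * m / ((γ : ℝ) + 1)) /
          (Real.sin (π * m / (2 * α * ((γ : ℝ) - 1) * ((γ : ℝ) + 1))) *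
            Real.sin (π * m / ((γ : ℝ) + 1))) -
         Real.sin (π * m * ((((γ + 1) / 2 : ℕ) : ℝ) - 1 + 1 / (2 * α * ((γ : ℝ) + 1))) / ((γ : ℝ) - 1)) *
            Real.sin (((((γ + 1) / 2 : ℕ) : ℝ) - 1) * π * m / ((γ : ℝ) - 1)) /
          (Real.sin (π * m / (2 * α * ((γ : ℝ) - 1) * ((γ : ℝ) + 1))) *
            Real.sin (π * m / ((γ : ℝ) - 1)))) := by

  obtain ⟨a, rfl⟩ : ∃ a, γ = a + 1 := ⟨γ - 1, by omega⟩
  have ha : 2 ≤ a := by omega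
  have hn' : n = 2 * (α * a * (a + 2)) := by rw [hn, Nat.add_sub_cancel]; ring
  have hs : 1 ≤ α * a := Nat.mul_pos hα (by omega)
  have hbig : a + 2 ≤ α * a * (a + 2) := Nat.le_mul_of_pos_left _ hs
  rw [energy_eq n (a + 1) hγ (by omega)]
  clear hn
  subst hn'
  rw [energy_sum a α ((a + 1 + 1) / 2) ha hα rfl]
  have hc : 1 ≤ (a + 1 + 1) / 2 := by omega
  generalize (a + 1 + 1) / 2 = c at *
  congr 1
  apply Finset.sum_congr rfl
  intro m hm
  have hm' : m = 1 ∨ m = a + 1 := by simpa using hm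
  have ha0 : (a : ℝ) ≠ 0 := by positivity
  have hα0 : (α : ℝ) ≠ 0 := by positivity
  have hb0 : (a : ℝ) + 2 ≠ 0 := by positivity
  have e1 : ((a + 1 : ℕ) : ℝ) - 1 = a := by push_cast; ring
  have e2 : ((a + 1 : ℕ) : ℝ) + 1 = ((a + 2 : ℕ) : ℝ) := by push_cast; ring
  have e3 : π * m / (2 * α * (a : ℝ) * ((a + 2 : ℕ) : ℝ)) = π * m / ((2 * (α * a * (a + 2)) : ℕ) : ℝ) := by
    push_cast; congr 1; ring
  rw [e1, e2, e3]
  congr 1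
  · apply term_eq (π * m / ((2 * (α * a * (a + 2)) : ℕ) : ℝ)) _ _ _ _ _ c
      (sin_ne m (a + 2) (by omega) (by omega))
    · apply Finset.sum_congr rfl
      intro k _
      congr 1
      push_cast; field_simp; ring
    · push_cast; field_simp; ring
    · ring
  · apply term_eq (π * m / ((2 * (α * a * (a + 2)) : ℕ) : ℝ)) _ _ _ _ _ (c - 1)
      (sin_ne' a m ha hm')
    · apply Finset.sum_congr rfl
      intro k _
      congr 1
      push_cast; field_simp; ring
    · rw [Nat.cast_sub hc]; push_cast; field_simp; ring
    · rw [Nat.cast_sub hc]; push_cast; ring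
end

section
/- Let γ ≥ 3 and α ≥ 1 be integers and set n = 2α(γ−1)(γ+1). Then 2·∑_{k=0}^{n−1} |cos(2πk/n) + cos(2πγk/n)| = 4·∑_{m∈{1,γ}} ( sin(πm(⌈γ/2⌉ + 1/(2α(γ−1)))/(γ+1))·sin(⌈γ/2⌉πm/(γ+1)) / (sin(πm/(2α(γ−1)(γ+1)))·sin(πm/(γ+1))) − sin(πm(⌈γ/2⌉ − 1 + 1/(2α(γ+1)))/(γ−1))·sin((⌈γ/2⌉−1)πm/(γ−1)) / (sin(πm/(2α(γ−1)(γ+1)))·sin(πm/(γ−1))) ), where ⌈·⌉ is the ceiling function. -/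
open Real Finset

/-- Dirichlet kernel. -/
lemma aux_dirichlet (t : ℝ) (K : ℕ) :
    (∑ k ∈ range K, (cos (2 * t * k) + cos (2 * t * ((k + 1 : ℕ) : ℝ))) + cos (2 * t * K)) * sin t
      = sin (2 * t * K + t) := by
  induction K with
  | zero => simp
  | succ K ih =>
    rw [sum_range_succ]
    have e : 2 * t * ((K + 1 : ℕ) : ℝ) = 2 * t * K + t + t := by push_cast; ring
    rw [e]
    have h1 : cos (2 * t * K) = cos (2 * t * K + t) * cos t + sin (2 * t * K + t) * sin t := by
      rw [← cos_sub]; ring_nf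
    have h2 : sin (2 * t * K) = sin (2 * t * K + t) * cos t - cos (2 * t * K + t) * sin t := by
      rw [← sin_sub]; ring_nf
    generalize 2 * t * (K : ℝ) + t = u at *
    rw [sin_add (u + t), cos_add, sin_add]
    have h3 := sin_sq_add_cos_sq t
    linear_combination ih - sin u * h3

lemma aux_sinsum (a b : ℝ) (c : ℕ) :
    (∑ j ∈ range c, sin (2 * b * j + a)) * sin b = sin (c * b) * sin (a + (c - 1) * b) := by
  induction c with
  | zero => simp
  | succ c ih =>
    rw [sum_range_succ, add_mul, ih]
    have e1 : 2 * b * (c : ℝ) + a = (a + c * b) + c * b := by ring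
    have e2 : a + ((c : ℝ) - 1) * b = (a + c * b) - b := by ring
    have e3 : a + (((c + 1 : ℕ) : ℝ) - 1) * b = a + c * b := by push_cast; ring
    have e4 : ((c + 1 : ℕ) : ℝ) * b = c * b + b := by push_cast; ring
    rw [e1, e2, e3, e4]
    generalize a + (c : ℝ) * b = u
    generalize (c : ℝ) * b = v
    rw [sin_add, sin_add, sin_sub]
    ring

lemma aux_term (m c A n : ℕ) (q : ℝ) (hA : 0 < A) (hq : 0 < q) (hn : (n : ℝ) = 2 * A * q)
    (h1 : sin (π * m / n) ≠ 0) (h2 : sin (π * m / q) ≠ 0) :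
    sin (π * m * (c + 1 / (2 * A)) / q) * sin (c * π * m / q) / (sin (π * m / n) * sin (π * m / q))
    = ∑ j ∈ range c, (∑ k ∈ range ((2 * j + 1) * A), (cos (2 * (π * m / n) * k)
        + cos (2 * (π * m / n) * ((k + 1 : ℕ) : ℝ)))
        + cos (2 * (π * m / n) * (((2 * j + 1) * A : ℕ) : ℝ))) := by
  have hA' : (0 : ℝ) < A := by exact_mod_cast hA
  rw [div_eq_iff (mul_ne_zero h1 h2), ← mul_assoc, sum_mul]
  simp_rw [aux_dirichlet]
  have e : ∀ j : ℕ, 2 * (π * m / n) * (((2 * j + 1) * A : ℕ) : ℝ) + π * m / n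
      = 2 * (π * m / q) * j + (π * m / q + π * m / n) := by
    intro j
    rw [hn]; push_cast; field_simp; ring
  simp_rw [e]
  rw [aux_sinsum, mul_comm]
  congr 2
  · ring
  · rw [hn]; field_simp; ring

lemma aux_reflect (g : ℕ → ℝ) (H : ℕ) (hg : ∀ k ≤ H, g (2 * H - k) = g k) :
    ∑ k ∈ range (2 * H), g k = ∑ k ∈ range H, (g k + g (k + 1)) := by
  rw [two_mul, sum_range_add, sum_add_distrib]
  congr 1
  rw [← sum_range_reflect]
  apply sum_congr rfl
  intro k hk
  have := mem_range.1 hk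
  rw [← hg (k + 1) (by omega)]
  congr 1; omega

lemma aux_ind (F : ℕ → ℝ) (K H : ℕ) (hK : K ≤ H) (h0 : F K = 0) :
    ∑ k ∈ range K, (F k + F (k + 1)) + F K
      = ∑ k ∈ range H, ((if k ≤ K then F k else 0) + (if k + 1 ≤ K then F (k + 1) else 0)) := by
  obtain ⟨r, rfl⟩ := Nat.exists_eq_add_of_le hK
  rw [sum_range_add, h0, add_zero]
  have : ∑ x ∈ range r, ((if K + x ≤ K then F (K + x) else 0)
      + (if K + x + 1 ≤ K then F (K + x + 1) else 0)) = 0 := by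
    apply sum_eq_zero
    intro x _
    rcases Nat.eq_zero_or_pos x with rfl | hx
    · simp [h0]
    · rw [if_neg (by omega), if_neg (by omega), add_zero]
  rw [this, add_zero]
  apply sum_congr rfl
  intro k hk
  have := mem_range.1 hk
  rw [if_pos (by omega), if_pos (by omega)]

lemma aux_count (A k c P : ℕ) (x : ℝ) (hP : P ≤ c) (h1 : k ≤ (2 * P + 1) * A)
    (h2 : 2 * P * A < k + A) :
    ∑ j ∈ range c, (if k ≤ (2 * j + 1) * A then x else 0) = (c - P) * x := by
  obtain ⟨r, rfl⟩ := Nat.exists_eq_add_of_le hP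
  rw [sum_range_add]
  have e1 : ∑ j ∈ range P, (if k ≤ (2 * j + 1) * A then x else 0) = 0 := by
    apply sum_eq_zero
    intro j hj
    have := mem_range.1 hj
    rw [if_neg]
    intro h
    have : (2 * j + 2) * A ≤ 2 * P * A := Nat.mul_le_mul_right _ (by omega)
    nlinarith
  have e2 : ∑ j ∈ range r, (if k ≤ (2 * (P + j) + 1) * A then x else 0) = ∑ j ∈ range r, x := by
    apply sum_congr rfl
    intro j hj
    rw [if_pos]
    exact h1.trans (Nat.mul_le_mul_right _ (by omega))
  rw [e1, e2]
  simp

lemma aux_exP (A k : ℕ) (hA : 0 < A) : ∃ P, k ≤ (2 * P + 1) * A ∧ 2 * P * A < k + A := by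
  refine ⟨(k + A - 1) / (2 * A), ?_, ?_⟩
  · have := Nat.lt_mul_div_succ (k + A - 1) (show 0 < 2 * A by omega)
    generalize (k + A - 1) / (2 * A) = P at *
    have h : 2 * A * (P + 1) = (2 * P + 1) * A + A := by ring
    omega
  · have := Nat.mul_div_le (k + A - 1) (2 * A)
    generalize (k + A - 1) / (2 * A) = P at *
    have h : 2 * A * P = 2 * P * A := by ring
    omega

lemma aux_sign (A k P : ℕ) (hA : 0 < A) (h1 : k ≤ (2 * P + 1) * A) (h2 : 2 * P * A < k + A) :
    0 ≤ (-1) ^ P * cos (π * k / (2 * A)) := by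
  have hA' : (0 : ℝ) < A := by exact_mod_cast hA
  have h1' : (k : ℝ) ≤ (2 * P + 1) * A := by exact_mod_cast h1
  have h2' : 2 * P * A < (k : ℝ) + A := by exact_mod_cast h2
  rw [← cos_sub_nat_mul_pi]
  have e : π * k / (2 * A) - P * π = π * ((k - 2 * P * A) / (2 * A)) := by field_simp
  have u : ((k : ℝ) - 2 * P * A) / (2 * A) ≤ 1 / 2 := by
    rw [div_le_div_iff₀ (by positivity) (by norm_num)]; linarith
  have l : -(1 / 2) ≤ ((k : ℝ) - 2 * P * A) / (2 * A) := by
    rw [le_div_iff₀ (by positivity)]; linarith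
  rw [e]
  apply cos_nonneg_of_neg_pi_div_two_le_of_le <;> nlinarith [pi_pos]

lemma aux_zero (A j : ℕ) (hA : 0 < A) : cos (π * (((2 * j + 1) * A : ℕ) : ℝ) / (2 * A)) = 0 := by
  have hA' : (0 : ℝ) < A := by exact_mod_cast hA
  rw [cos_eq_zero_iff]
  refine ⟨j, ?_⟩
  push_cast; field_simp

lemma aux_pt (d α k : ℕ) (F : ℕ → ℝ) (hd : 2 ≤ d) (hα : 1 ≤ α) (hk : k ≤ α * d * (d + 2))
    (hF : F k = 2 * (cos (π * k / (2 * (α * d : ℕ))) * cos (π * k / (2 * (α * (d + 2) : ℕ))))) :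
    2 * (∑ j ∈ range ((d + 2) / 2), (if k ≤ (2 * j + 1) * (α * d) then F k else 0)
      - ∑ j ∈ range ((d + 2) / 2 - 1), (if k ≤ (2 * j + 1) * (α * (d + 2)) then F k else 0))
      = F k + |F k| := by
  have hA : 0 < α * d := by positivity
  have hB : 0 < α * (d + 2) := by positivity
  obtain ⟨P, p1, p2⟩ := aux_exP (α * d) k hA
  obtain ⟨Q, q1, q2⟩ := aux_exP (α * (d + 2)) k hB
  have sP := aux_sign _ k P hA p1 p2
  have sQ := aux_sign _ k Q hB q1 q2
  have hPc : P ≤ (d + 2) / 2 := by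
    by_contra h
    have h' : d + 3 ≤ 2 * P := by omega
    have := Nat.mul_le_mul_right (α * d) h'
    nlinarith
  have hQc : Q ≤ (d + 2) / 2 - 1 := by
    by_contra h
    have h' : d + 1 ≤ 2 * Q := by omega
    have := Nat.mul_le_mul_right (α * (d + 2)) h'
    nlinarith
  have hQP : Q ≤ P := by
    by_contra h
    have h' : 2 * P + 2 ≤ 2 * Q := by omega
    have := Nat.mul_le_mul_right (α * (d + 2)) h'
    nlinarith [Nat.zero_le (P * α)]
  have hPQ : P ≤ Q + 1 := by
    by_contra h
    have h' : 2 * Q + 4 ≤ 2 * P := by omega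
    have h3 := Nat.mul_le_mul_right (α * d) h'
    have h4 : 2 * Q + 2 ≤ d := by omega
    have h5 := Nat.mul_le_mul_right α h4
    nlinarith
  rw [aux_count _ _ _ P _ hPc p1 p2, aux_count _ _ _ Q _ hQc q1 q2]
  rw [Nat.cast_sub (by omega : 1 ≤ (d + 2) / 2)]
  have hm := mul_nonneg sP sQ
  have hm' : 0 ≤ ((-1) ^ P * (-1) ^ Q) * F k := by rw [hF]; nlinarith
  rcases (by omega : P = Q ∨ P = Q + 1) with h | h
  · subst h
    rw [← mul_pow] at hm'
    norm_num at hm'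
    rw [abs_of_nonneg hm']; push_cast; ring
  · subst h
    rw [pow_succ, mul_right_comm ((-1 : ℝ) ^ Q) (-1) ((-1) ^ Q), ← mul_pow] at hm'
    norm_num at hm'
    rw [abs_of_nonpos hm']; push_cast; ring

lemma aux_F (d α k n : ℕ) (hd : 2 ≤ d) (hα : 1 ≤ α) (hn : n = 2 * (α * d * (d + 2))) :
    cos (2 * (π * (1 : ℕ) / n) * k) + cos (2 * (π * (d + 1 : ℕ) / n) * k)
    = 2 * (cos (π * k / (2 * (α * d : ℕ))) * cos (π * k / (2 * (α * (d + 2) : ℕ)))) := by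
  have hd' : (0 : ℝ) < d := by exact_mod_cast (by omega : 0 < d)
  have ha' : (0 : ℝ) < α := by exact_mod_cast (by omega : 0 < α)
  subst hn
  have e1 : 2 * (π * (1 : ℕ) / (2 * (α * d * (d + 2)) : ℕ)) * k
      = π * k / (2 * (α * d : ℕ)) - π * k / (2 * (α * (d + 2) : ℕ)) := by
    push_cast; field_simp; ring
  have e2 : 2 * (π * (d + 1 : ℕ) / (2 * (α * d * (d + 2)) : ℕ)) * k
      = π * k / (2 * (α * d : ℕ)) + π * k / (2 * (α * (d + 2) : ℕ)) := by
    push_cast; field_simp; ring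
  rw [e1, e2, cos_add, cos_sub]; ring

lemma aux_sum0 (m n H : ℕ) (hH : 0 < H) (hn : n = 2 * H) (h1 : sin (π * m / n) ≠ 0) :
    ∑ k ∈ range H, (cos (2 * (π * m / n) * k) + cos (2 * (π * m / n) * ((k + 1 : ℕ) : ℝ))) = 0 := by
  have h := aux_dirichlet (π * m / n) H
  have hH' : (0 : ℝ) < H := by exact_mod_cast hH
  have e : 2 * (π * m / n) * H = m * π := by subst hn; push_cast; field_simp
  rw [e, sin_add, sin_nat_mul_pi, zero_mul, zero_add] at h
  have := mul_right_cancel₀ h1 h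
  linarith

lemma aux_sin_pos (x : ℝ) (h0 : 0 < x) (h1 : x < 1) : sin (π * x) ≠ 0 :=
  (sin_pos_of_pos_of_lt_pi (by positivity) (by nlinarith [pi_pos])).ne'



/-- For integers `γ ≥ 3`, `α ≥ 1` and `n = 2α(γ-1)(γ+1)`, the closed form of
`2 ∑_{k=0}^{n-1} |cos(2πk/n) + cos(2πγk/n)|`. Here `⌈γ/2⌉ = (γ+1)/2` (natural division). -/
theorem sum_abs_cos_closed_form (γ α n : ℕ) (hγ : 3 ≤ γ) (hα : 1 ≤ α)
    (hn : n = 2 * α * (γ - 1) * (γ + 1)) :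
    2 * ∑ k ∈ Finset.range n,
        |Real.cos (2 * π * k / n) + Real.cos (2 * π * γ * k / n)| =
      4 * ∑ m ∈ ({1, γ} : Finset ℕ),
        (Real.sin (π * m * ((((γ + 1) / 2 : ℕ) : ℝ) + 1 / (2 * α * ((γ : ℝ) - 1))) / ((γ : ℝ) + 1)) *
            Real.sin ((((γ + 1) / 2 : ℕ) : ℝ) * π * m / ((γ : ℝ) + 1)) /
          (Real.sin (π * m / (2 * α * ((γ : ℝ) - 1) * ((γ : ℝ) + 1))) *
            Real.sin (π * m / ((γ : ℝ) + 1))) -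
         Real.sin (π * m * ((((γ + 1) / 2 : ℕ) : ℝ) - 1 + 1 / (2 * α * ((γ : ℝ) + 1))) / ((γ : ℝ) - 1)) *
            Real.sin (((((γ + 1) / 2 : ℕ) : ℝ) - 1) * π * m / ((γ : ℝ) - 1)) /
          (Real.sin (π * m / (2 * α * ((γ : ℝ) - 1) * ((γ : ℝ) + 1))) *
            Real.sin (π * m / ((γ : ℝ) - 1)))) := by
  obtain ⟨d, rfl⟩ : ∃ d, γ = d + 1 := ⟨γ - 1, by omega⟩
  have hd : 2 ≤ d := by omega
  have hn' : n = 2 * (α * d * (d + 2)) := by rw [hn, Nat.add_sub_cancel]; ring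
  clear hn
  have hH : 0 < α * d * (d + 2) := by positivity
  have hd' : (2 : ℝ) ≤ d := by exact_mod_cast hd
  have ha' : (1 : ℝ) ≤ α := by exact_mod_cast hα
  have hnR : (n : ℝ) = 2 * (α * d * (d + 2)) := by rw [hn']; push_cast; ring
  have hnpos : (0 : ℝ) < n := by rw [hnR]; positivity
  have had : (d : ℝ) ≤ α * d := by nlinarith
  have hbig : (d : ℝ) + 1 < n := by rw [hnR]; nlinarith
  have s1 : sin (π * (1 : ℕ) / n) ≠ 0 := by
    rw [mul_div_assoc]
    refine aux_sin_pos _ (by positivity) ?_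
    rw [div_lt_one hnpos]; push_cast; linarith
  have s2 : sin (π * (d + 1 : ℕ) / n) ≠ 0 := by
    rw [mul_div_assoc]
    refine aux_sin_pos _ (by positivity) ?_
    rw [div_lt_one hnpos]; push_cast; linarith
  have s3 : sin (π * (1 : ℕ) / ((d : ℝ) + 2)) ≠ 0 := by
    rw [mul_div_assoc]
    refine aux_sin_pos _ (by positivity) ?_
    rw [div_lt_one (by positivity)]; push_cast; linarith
  have s4 : sin (π * (d + 1 : ℕ) / ((d : ℝ) + 2)) ≠ 0 := by
    rw [mul_div_assoc]
    refine aux_sin_pos _ (by positivity) ?_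
    rw [div_lt_one (by positivity)]; push_cast; linarith
  have s5 : sin (π * (1 : ℕ) / (d : ℝ)) ≠ 0 := by
    rw [mul_div_assoc]
    refine aux_sin_pos _ (by positivity) ?_
    rw [div_lt_one (by positivity)]; push_cast; linarith
  have s6 : sin (π * (d + 1 : ℕ) / (d : ℝ)) ≠ 0 := by
    have e : π * (d + 1 : ℕ) / (d : ℝ) = π * (1 : ℕ) / d + π := by
      push_cast; field_simp; ring
    rw [e, sin_add_pi]
    exact neg_ne_zero.2 s5
  set F : ℕ → ℝ := fun k => cos (2 * (π * (1 : ℕ) / n) * k) + cos (2 * (π * (d + 1 : ℕ) / n) * k)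
    with hFdef
  have hF : ∀ k, F k = 2 * (cos (π * k / (2 * (α * d : ℕ)))
      * cos (π * k / (2 * (α * (d + 2) : ℕ)))) := fun k => aux_F d α k n hd hα hn'
  have hL : ∑ k ∈ range n, |cos (2 * π * k / n) + cos (2 * π * (d + 1 : ℕ) * k / n)|
      = ∑ k ∈ range (α * d * (d + 2)), (|F k| + |F (k + 1)|) := by
    rw [← aux_reflect (fun k => |F k|), ← hn']
    · apply sum_congr rfl
      intro k _
      simp only [hFdef]
      congr 3
      · push_cast; ring
      · ring
    · intro k hk
      have e : ∀ m : ℕ, cos (2 * (π * m / n) * ((2 * (α * d * (d + 2)) - k : ℕ) : ℝ))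
          = cos (2 * (π * m / n) * k) := by
        intro m
        rw [Nat.cast_sub (by omega), ← hn', ← cos_nat_mul_two_pi_sub _ m]
        congr 1
        field_simp; ring
      simp only [hFdef, e]
  have hz : ∑ k ∈ range (α * d * (d + 2)), (F k + F (k + 1)) = 0 := by
    have z1 := aux_sum0 1 n _ hH hn' s1
    have z2 := aux_sum0 (d + 1) n _ hH hn' s2
    rw [sum_add_distrib] at z1 z2 ⊢
    simp only [hFdef, sum_add_distrib]
    linarith
  set c := (d + 2) / 2 with hc
  have hc1 : 1 ≤ c := by omega
  have hcc : ((c - 1 : ℕ) : ℝ) = (c : ℝ) - 1 := by rw [Nat.cast_sub hc1]; simp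
  have hA : 0 < α * d := by positivity
  have hB : 0 < α * (d + 2) := by positivity
  have T : ∀ m : ℕ, sin (π * m / n) ≠ 0 → sin (π * m / ((d : ℝ) + 2)) ≠ 0 →
      sin (π * m / (d : ℝ)) ≠ 0 →
      (sin (π * m * ((c : ℝ) + 1 / (2 * α * (((d + 1 : ℕ) : ℝ) - 1))) / (((d + 1 : ℕ) : ℝ) + 1)) *
            sin ((c : ℝ) * π * m / (((d + 1 : ℕ) : ℝ) + 1)) /
          (sin (π * m / (2 * α * (((d + 1 : ℕ) : ℝ) - 1) * (((d + 1 : ℕ) : ℝ) + 1))) *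
            sin (π * m / (((d + 1 : ℕ) : ℝ) + 1))) -
         sin (π * m * ((c : ℝ) - 1 + 1 / (2 * α * (((d + 1 : ℕ) : ℝ) + 1)))
            / (((d + 1 : ℕ) : ℝ) - 1)) *
            sin (((c : ℝ) - 1) * π * m / (((d + 1 : ℕ) : ℝ) - 1)) /
          (sin (π * m / (2 * α * (((d + 1 : ℕ) : ℝ) - 1) * (((d + 1 : ℕ) : ℝ) + 1))) *
            sin (π * m / (((d + 1 : ℕ) : ℝ) - 1)))) =
      ∑ j ∈ range c, (∑ k ∈ range ((2 * j + 1) * (α * d)), (cos (2 * (π * m / n) * k)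
        + cos (2 * (π * m / n) * ((k + 1 : ℕ) : ℝ)))
        + cos (2 * (π * m / n) * (((2 * j + 1) * (α * d) : ℕ) : ℝ)))
      - ∑ j ∈ range (c - 1), (∑ k ∈ range ((2 * j + 1) * (α * (d + 2))), (cos (2 * (π * m / n) * k)
        + cos (2 * (π * m / n) * ((k + 1 : ℕ) : ℝ)))
        + cos (2 * (π * m / n) * (((2 * j + 1) * (α * (d + 2)) : ℕ) : ℝ))) := by
    intro m h1 h2 h3
    rw [← aux_term m c (α * d) n ((d : ℝ) + 2) hA (by positivity) (by rw [hnR]; push_cast; ring) h1 h2,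
      ← aux_term m (c - 1) (α * (d + 2)) n (d : ℝ) hB (by positivity)
        (by rw [hnR]; push_cast; ring) h1 h3, hcc]
    have e1 : ((d + 1 : ℕ) : ℝ) - 1 = d := by push_cast; ring
    have e2 : ((d + 1 : ℕ) : ℝ) + 1 = d + 2 := by push_cast; ring
    have e3 : 2 * (α : ℝ) * d * (d + 2) = n := by rw [hnR]; ring
    have e4 : 2 * ((α * d : ℕ) : ℝ) = 2 * α * d := by push_cast; ring
    have e5 : 2 * ((α * (d + 2) : ℕ) : ℝ) = 2 * α * (d + 2) := by push_cast; ring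
    rw [e1, e2, e3, e4, e5]
  have hne : (1 : ℕ) ≠ d + 1 := by omega
  rw [sum_pair hne, hL]
  rw [T 1 s1 s3 s5, T (d + 1) s2 s4 s6]
  have key : ∀ A r : ℕ, (∀ j < r, (2 * j + 1) * A ≤ α * d * (d + 2)) →
      (∀ j, F ((2 * j + 1) * A) = 0) →
      ∑ j ∈ range r, (∑ k ∈ range ((2 * j + 1) * A), (cos (2 * (π * (1 : ℕ) / n) * k)
        + cos (2 * (π * (1 : ℕ) / n) * ((k + 1 : ℕ) : ℝ)))
        + cos (2 * (π * (1 : ℕ) / n) * (((2 * j + 1) * A : ℕ) : ℝ)))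
      + ∑ j ∈ range r, (∑ k ∈ range ((2 * j + 1) * A), (cos (2 * (π * (d + 1 : ℕ) / n) * k)
        + cos (2 * (π * (d + 1 : ℕ) / n) * ((k + 1 : ℕ) : ℝ)))
        + cos (2 * (π * (d + 1 : ℕ) / n) * (((2 * j + 1) * A : ℕ) : ℝ)))
      = ∑ k ∈ range (α * d * (d + 2)), (∑ j ∈ range r, (if k ≤ (2 * j + 1) * A then F k else 0)
        + ∑ j ∈ range r, (if k + 1 ≤ (2 * j + 1) * A then F (k + 1) else 0)) := by
    intro A r hr h0
    simp_rw [← sum_add_distrib]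
    rw [sum_comm (s := range (α * d * (d + 2)))]
    apply sum_congr rfl
    intro j hj
    rw [← aux_ind F _ _ (hr j (mem_range.1 hj)) (h0 j)]
    simp only [hFdef, sum_add_distrib]
    ring
  have kA := key (α * d) c (by
      intro j hj
      rw [mul_comm]
      exact Nat.mul_le_mul_left _ (by omega)) (by
      intro j
      rw [hF, aux_zero _ _ hA]; ring)
  have kB := key (α * (d + 2)) (c - 1) (by
      intro j hj
      have : 2 * j + 1 ≤ d := by omega
      have := Nat.mul_le_mul_right (α * (d + 2)) this
      nlinarith) (by
      intro j
      rw [hF, aux_zero _ _ hB]; ring)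
  have fin : 2 * (∑ k ∈ range (α * d * (d + 2)),
        (∑ j ∈ range c, (if k ≤ (2 * j + 1) * (α * d) then F k else 0)
        + ∑ j ∈ range c, (if k + 1 ≤ (2 * j + 1) * (α * d) then F (k + 1) else 0))
      - ∑ k ∈ range (α * d * (d + 2)),
        (∑ j ∈ range (c - 1), (if k ≤ (2 * j + 1) * (α * (d + 2)) then F k else 0)
        + ∑ j ∈ range (c - 1), (if k + 1 ≤ (2 * j + 1) * (α * (d + 2)) then F (k + 1) else 0)))
      = ∑ k ∈ range (α * d * (d + 2)), (F k + F (k + 1))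
        + ∑ k ∈ range (α * d * (d + 2)), (|F k| + |F (k + 1)|) := by
    rw [← sum_sub_distrib, mul_sum, ← sum_add_distrib]
    apply sum_congr rfl
    intro k hk
    have hk' := mem_range.1 hk
    have p1 := aux_pt d α k F hd hα hk'.le (hF k)
    have p2 := aux_pt d α (k + 1) F hd hα hk' (hF (k + 1))
    rw [← hc] at p1 p2
    linarith
  rw [hz, zero_add] at fin
  linarith
end
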